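/- Let n = 3k, let s be a positive integer, let α ∈ L* where L = GF(2^n), and let f(x) = x^{2^s+1} + α x^{2^{−k}+2^{k+s}}. For b ∈ L* define the linearized map L_b(u) = b u^{2^s} + (b u)^{2^{−s}} + (bα)^{2^k} u^{2^{−k+s}} + (bα)^{2^{−k−s}} u^{2^{k−s}}, and let K = {u ∈ L : L_b(u) = 0}. Then for every a ∈ L and b ∈ L*, (f^W(a,b))^2 = 2^n · Σ_{u ∈ K} (−1)^{Tr(a u + b u^{2^s+1} + b α u^{2^{−k}+2^{k+s}})}. -/

import Mathlib

lemma pow_two_pow_mul_eq_self {L : Type*} [Field L] [Fintype L] {n : ℕ}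
    (hcard : Fintype.card L = 2 ^ n) (m : ℕ) (x : L) :
    x ^ 2 ^ (n * m) = x := by
  rw [pow_mul, ← hcard, FiniteField.pow_card_pow]

/-- The canonical additive character `x ↦ (-1)^{Tr x}` in characteristic two. -/
noncomputable def traceSign (L : Type*) [Field L] [Algebra (ZMod 2) L] (x : L) : ℤ :=
  (-1 : ℤ) ^ (Algebra.trace (ZMod 2) L x).val

section TraceSign

variable {L : Type*} [Field L] [Algebra (ZMod 2) L]

lemma traceSign_add (x y : L) :
    traceSign L (x + y) = traceSign L x * traceSign L y := by
  simp only [traceSign, map_add]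
  generalize Algebra.trace (ZMod 2) L x = p
  generalize Algebra.trace (ZMod 2) L y = q
  revert p q
  decide

lemma traceSign_zero : traceSign L 0 = 1 := by
  simp [traceSign]

variable [Fintype L]

lemma trace_pow_two_pow (j : ℕ) (x : L) :
    Algebra.trace (ZMod 2) L (x ^ 2 ^ j) = Algebra.trace (ZMod 2) L x := by
  induction j generalizing x with
  | zero => simp
  | succ j ih =>
    rw [pow_succ, pow_mul]
    have h := Algebra.trace_eq_of_algEquiv (FiniteField.frobeniusAlgEquivOfAlgebraic (ZMod 2) L)
      (x ^ 2 ^ j)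
    rw [← ih x, ← h]
    simp

lemma traceSign_pow_two_pow (j : ℕ) (x : L) : traceSign L (x ^ 2 ^ j) = traceSign L x := by
  simp only [traceSign, trace_pow_two_pow]

lemma exists_traceSign_mul_eq_neg_one {c : L} (hc : c ≠ 0) :
    ∃ y, traceSign L (c * y) = -1 := by
  obtain ⟨z, hz⟩ := Algebra.trace_surjective (ZMod 2) L 1
  refine ⟨c⁻¹ * z, ?_⟩
  rw [mul_inv_cancel_left₀ hc, traceSign, hz]
  rfl

lemma sum_traceSign_mul [DecidableEq L] (c : L) :
    ∑ x : L, traceSign L (c * x) = if c = 0 then (Fintype.card L : ℤ) else 0 := by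
  split_ifs with hc
  · simp [hc, traceSign_zero]
  · obtain ⟨y, hy⟩ := exists_traceSign_mul_eq_neg_one hc
    have h := Fintype.sum_equiv (Equiv.addRight y) (fun x => traceSign L (c * (x + y)))
      (fun x => traceSign L (c * x)) (fun x => rfl)
    simp only [mul_add, traceSign_add, hy, ← Finset.sum_mul] at h
    linarith

/-- If the derivative of `g` in direction `u` is, up to the constant `g u`, dual to `D u` under the
trace form, then the square of the sum of the signs of `g` reduces to the zeros of `D`. -/
lemma sq_sum_traceSign [DecidableEq L] (g D : L → L)
    (h : ∀ x u, traceSign L (g (x + u) + g x) = traceSign L (g u) * traceSign L (D u * x)) :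
    (∑ x, traceSign L (g x)) ^ 2 =
      Fintype.card L * ∑ u ∈ Finset.univ.filter (fun u => D u = 0), traceSign L (g u) := by
  calc (∑ x, traceSign L (g x)) ^ 2
      = ∑ x, ∑ u, traceSign L (g (x + u) + g x) := by
        rw [sq, Finset.sum_mul_sum]
        refine Finset.sum_congr rfl fun x _ => ?_
        rw [← Equiv.sum_comp (Equiv.addLeft x)]
        refine Finset.sum_congr rfl fun u _ => ?_
        rw [traceSign_add, mul_comm, Equiv.coe_addLeft]
    _ = ∑ u, traceSign L (g u) * ∑ x, traceSign L (D u * x) := by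
        rw [Finset.sum_comm]
        simp only [h, Finset.mul_sum]
    _ = _ := by
        simp only [sum_traceSign_mul, Finset.mul_sum, Finset.sum_filter]
        refine Finset.sum_congr rfl fun u _ => ?_
        split_ifs <;> ring

end TraceSign


/-- Let `n = 3k`, `s` a positive integer, `α ∈ L^*` with `L = GF(2^n)`, and
`f(x) = x^{2^s+1} + α x^{2^{-k}+2^{k+s}}`.  For `b ∈ L^*` let
`L_b(u) = b u^{2^s} + (bu)^{2^{-s}} + (bα)^{2^k} u^{2^{-k+s}} + (bα)^{2^{-k-s}} u^{2^{k-s}}`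
and `K = {u ∈ L : L_b(u) = 0}`.  Then for every `a ∈ L` and `b ∈ L^*`,
`(f^W(a,b))² = 2^n · ∑_{u ∈ K} (-1)^{Tr(au + b u^{2^s+1} + bα u^{2^{-k}+2^{k+s}})}`.
(An exponent `2^{-j}` denotes `2^{n-j}`; a Frobenius index `-j` is rendered by the
representative `n - j % n`, which agrees with it modulo `n`, hence modulo `2^n - 1`
on exponents.) -/
theorem stmt8 (k s : ℕ) (hk : 0 < k) (hs : 0 < s)
    (L : Type*) [Field L] [Fintype L] [DecidableEq L] [Algebra (ZMod 2) L]
    (hcard : Fintype.card L = 2 ^ (3 * k))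
    (α : L) (hα : α ≠ 0)
    (f : L → L)
    (hf : ∀ x, f x = x ^ (2 ^ s + 1) + α * x ^ (2 ^ (2 * k) + 2 ^ (k + s)))
    (a b : L) (hb : b ≠ 0) :
    (∑ x : L, (-1 : ℤ) ^ (Algebra.trace (ZMod 2) L (a * x + b * f x)).val) ^ 2 =
      2 ^ (3 * k) *
        ∑ u ∈ Finset.univ.filter (fun u : L =>
            b * u ^ (2 ^ s) + (b * u) ^ (2 ^ (3 * k - s % (3 * k)))
              + (b * α) ^ (2 ^ k) * u ^ (2 ^ (2 * k + s))
              + (b * α) ^ (2 ^ (2 * k + (3 * k - s % (3 * k))))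
                * u ^ (2 ^ (k + (3 * k - s % (3 * k)))) = 0),
          (-1 : ℤ) ^ (Algebra.trace (ZMod 2) L
            (a * u + b * u ^ (2 ^ s + 1)
              + b * α * u ^ (2 ^ (2 * k) + 2 ^ (k + s)))).val := by
  have hchar : CharP L 2 := charP_of_injective_algebraMap (algebraMap (ZMod 2) L).injective 2
  have htwo : (2 : L) = 0 := CharTwo.two_eq_zero
  obtain ⟨t, m, ht, hm⟩ : ∃ t m, 3 * k - s % (3 * k) = t ∧ s + t = 3 * k * m := by
    refine ⟨_, s / (3 * k) + 1, rfl, ?_⟩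
    have h₁ := Nat.div_add_mod s (3 * k)
    have h₂ := Nat.mod_lt s (show 3 * k > 0 by omega)
    rw [mul_add]
    omega
  rw [ht]
  have key := sq_sum_traceSign
    (fun x : L => a * x + b * x ^ (2 ^ s + 1) + b * α * x ^ (2 ^ (2 * k) + 2 ^ (k + s)))
    (fun u => b * u ^ (2 ^ s) + (b * u) ^ (2 ^ t) + (b * α) ^ (2 ^ k) * u ^ (2 ^ (2 * k + s))
      + (b * α) ^ (2 ^ (2 * k + t)) * u ^ (2 ^ (k + t))) ?_
  · rw [hcard] at key
    push_cast at key
    simp only [traceSign] at key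
    rw [← key]
    simp only [hf, mul_add, mul_assoc, add_assoc]
  · intro x u
    have h₁ : traceSign L (b * u * x ^ 2 ^ s) = traceSign L ((b * u) ^ 2 ^ t * x) := by
      rw [← traceSign_pow_two_pow t, mul_pow (b * u), ← pow_mul, ← pow_add, hm,
        pow_two_pow_mul_eq_self hcard]
    have h₂ : traceSign L (b * α * u ^ 2 ^ (k + s) * x ^ 2 ^ (2 * k)) =
        traceSign L ((b * α) ^ 2 ^ k * u ^ 2 ^ (2 * k + s) * x) := by
      rw [← traceSign_pow_two_pow k, mul_pow _ (x ^ _), mul_pow (b * α), ← pow_mul, ← pow_mul,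
        ← pow_add, ← pow_add, show 2 * k + k = 3 * k * 1 by ring,
        pow_two_pow_mul_eq_self hcard, show k + s + k = 2 * k + s by ring]
    have h₃ : traceSign L (b * α * u ^ 2 ^ (2 * k) * x ^ 2 ^ (k + s)) =
        traceSign L ((b * α) ^ 2 ^ (2 * k + t) * u ^ 2 ^ (k + t) * x) := by
      rw [← traceSign_pow_two_pow (2 * k + t), mul_pow _ (x ^ _), mul_pow (b * α), ← pow_mul,
        ← pow_mul, ← pow_add, ← pow_add,
        show k + s + (2 * k + t) = 3 * k * (m + 1) by rw [mul_add, ← hm]; ring,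
        pow_two_pow_mul_eq_self hcard,
        show 2 * k + (2 * k + t) = 3 * k * 1 + (k + t) by ring, pow_add 2 (3 * k * 1),
        pow_mul u, pow_two_pow_mul_eq_self hcard]
    have expand : a * (x + u) + b * (x + u) ^ (2 ^ s + 1)
          + b * α * (x + u) ^ (2 ^ (2 * k) + 2 ^ (k + s))
          + (a * x + b * x ^ (2 ^ s + 1) + b * α * x ^ (2 ^ (2 * k) + 2 ^ (k + s)))
        = a * u + b * u ^ (2 ^ s + 1) + b * α * u ^ (2 ^ (2 * k) + 2 ^ (k + s))
          + (b * u ^ 2 ^ s * x + b * u * x ^ 2 ^ s + b * α * u ^ 2 ^ (k + s) * x ^ 2 ^ (2 * k)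
            + b * α * u ^ 2 ^ (2 * k) * x ^ 2 ^ (k + s)) := by
      simp only [pow_add _ (2 ^ s) 1, pow_add _ (2 ^ (2 * k)) (2 ^ (k + s)), pow_one,
        add_pow_char_pow x u]
      generalize x ^ 2 ^ s = x₁
      generalize x ^ 2 ^ (2 * k) = x₂
      generalize x ^ 2 ^ (k + s) = x₃
      linear_combination (a * x + b * x₁ * x + b * α * x₂ * x₃) * htwo
    simp only [expand, add_mul, traceSign_add, h₁, h₂, h₃]
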